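/- arXiv:math/0501265 — 2 statements merged into one kernel-verified Lean document; each statement's English description precedes it below -/
import Mathlib

section
/- Let n ≥ 1 and ν ≥ 2 be integers, let Δ = {0} × ℝⁿ ⊂ ℝⁿ × ℝⁿ and let p : ℝⁿ × ℝⁿ → ℝⁿ × ℝⁿ, p(x₁,x₂) = (0,x₂), be the projection onto Δ. Let U ⊆ ℝⁿ × ℝⁿ be open and convex, K ⊆ U compact with p(V) ∈ U for every V ∈ K, and let Ψ : ℝⁿ × ℝⁿ → ℝ be C^∞ and satisfy, for some c ≥ 1 and all V = (x₁,x₂) ∈ U, (1/c)‖x₁‖^ν ≤ Ψ(V) ≤ c‖x₁‖^ν. Then there exists C > 0 such that for every V = (x₁,x₂) ∈ K: the partial differential of Ψ at V with respect to the first variable satisfies ‖D₁Ψ(V)‖ ≤ C‖x₁‖^{ν−1}, and the partial differential with respect to the second variable satisfies ‖D₂Ψ(V)‖ ≤ C‖x₁‖^{ν}. -/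
open Set Filter Topology

namespace Stmt2Aux

variable {P : Type*} [NormedAddCommGroup P] [NormedSpace ℝ P]
variable {F : Type*} [NormedAddCommGroup F] [NormedSpace ℝ F]

/-- Derivative in the first (scalar) variable. -/
noncomputable def TD (f : ℝ × P → F) : ℝ × P → F := fun q => fderiv ℝ f q (1, 0)

/-- Derivative in the second variable. -/
noncomputable def PD (f : ℝ × P → F) : ℝ × P → (P →L[ℝ] F) :=
  fun q => (fderiv ℝ f q).comp (ContinuousLinearMap.inr ℝ ℝ P)

lemma TD_smooth {f : ℝ × P → F} (hf : ContDiff ℝ (⊤ : ℕ∞) f) :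
    ContDiff ℝ (⊤ : ℕ∞) (TD f) := by
  have h : ContDiff ℝ (⊤ : ℕ∞) (fderiv ℝ f) := hf.fderiv_right (by simp)
  exact h.clm_apply contDiff_const

lemma PD_smooth {f : ℝ × P → F} (hf : ContDiff ℝ (⊤ : ℕ∞) f) :
    ContDiff ℝ (⊤ : ℕ∞) (PD f) := by
  have h : ContDiff ℝ (⊤ : ℕ∞) (fderiv ℝ f) := hf.fderiv_right (by simp)
  exact h.clm_comp contDiff_const

lemma hasDerivAt_slice {f : ℝ × P → F} (hf : ContDiff ℝ (⊤ : ℕ∞) f) (t : ℝ) (p : P) :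
    HasDerivAt (fun s : ℝ => f (s, p)) (TD f (t, p)) t := by
  have h1 : HasFDerivAt f (fderiv ℝ f (t, p)) (t, p) :=
    (hf.differentiable (by simp) _).hasFDerivAt
  have h2 : HasDerivAt (fun s : ℝ => (s, p)) ((1 : ℝ), (0 : P)) t :=
    (hasDerivAt_id t).prodMk (hasDerivAt_const t p)
  exact h1.comp_hasDerivAt t h2

lemma TD_PD {f : ℝ × P → F} (hf : ContDiff ℝ (⊤ : ℕ∞) f) : TD (PD f) = PD (TD f) := by
  funext q
  have h : ContDiff ℝ (⊤ : ℕ∞) (fderiv ℝ f) := hf.fderiv_right (by simp)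
  have hd : HasFDerivAt (fderiv ℝ f) (fderiv ℝ (fderiv ℝ f) q) q :=
    (h.differentiable (by simp) q).hasFDerivAt
  have hsymm : IsSymmSndFDerivAt ℝ f q := hf.contDiffAt.isSymmSndFDerivAt (by
    rw [minSmoothness_of_isRCLikeNormedField]; exact WithTop.coe_le_coe.2 (le_top : (2 : ℕ∞) ≤ ⊤))
  ext v
  have e1 : fderiv ℝ (PD f) q (1, 0) v = fderiv ℝ (fderiv ℝ f) q (1, 0) (0, v) := by
    have := (hd.clm_comp (hasFDerivAt_const (ContinuousLinearMap.inr ℝ ℝ P) q)).fderiv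
    unfold PD
    rw [this]
    simp
  have e2 : fderiv ℝ (TD f) q (0, v) = fderiv ℝ (fderiv ℝ f) q (0, v) (1, 0) := by
    have := (hd.clm_apply (hasFDerivAt_const ((1 : ℝ), (0 : P)) q)).fderiv
    unfold TD
    rw [this]
    simp
  change fderiv ℝ (PD f) q (1, 0) v = fderiv ℝ (TD f) q (0, v)
  rw [e1, e2]
  exact hsymm _ _

lemma iter_PD (k : ℕ) : ∀ {f : ℝ × P → F}, ContDiff ℝ (⊤ : ℕ∞) f →
    TD^[k] (PD f) = PD (TD^[k] f) := by
  induction k with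
  | zero => intro f _; rfl
  | succ k ih =>
    intro f hf
    rw [Function.iterate_succ_apply, Function.iterate_succ_apply, TD_PD hf, ih (TD_smooth hf)]

lemma iter_smooth (k : ℕ) : ∀ {f : ℝ × P → F}, ContDiff ℝ (⊤ : ℕ∞) f →
    ContDiff ℝ (⊤ : ℕ∞) (TD^[k] f) := by
  induction k with
  | zero => intro f hf; exact hf
  | succ k ih => intro f hf; exact ih (TD_smooth hf)

lemma iter_eq_iteratedDeriv (k : ℕ) : ∀ {f : ℝ × P → F}, ContDiff ℝ (⊤ : ℕ∞) f →
    ∀ (t : ℝ) (p : P), TD^[k] f (t, p) = iteratedDeriv k (fun s => f (s, p)) t := by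
  induction k with
  | zero => intro f _ t p; simp
  | succ k ih =>
    intro f hf t p
    have : deriv (fun s => f (s, p)) = fun s => TD f (s, p) :=
      funext fun s => (hasDerivAt_slice hf s p).deriv
    rw [iteratedDeriv_succ', this, Function.iterate_succ_apply, ih (TD_smooth hf)]

lemma bound_of_vanish (m : ℕ) : ∀ {f : ℝ × P → F}, ContDiff ℝ (⊤ : ℕ∞) f →
    ∀ (S : Set P), IsCompact S → ∀ R : ℝ,
    (∀ p ∈ S, ∀ k < m, TD^[k] f (0, p) = 0) →
    ∃ C : ℝ, 0 ≤ C ∧ ∀ p ∈ S, ∀ t ∈ Icc 0 R, ‖f (t, p)‖ ≤ C * t ^ m := by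
  induction m with
  | zero =>
    intro f hf S hS R _
    obtain ⟨C, hC⟩ := ((isCompact_Icc (a := (0 : ℝ)) (b := R)).prod hS).exists_bound_of_continuousOn
      hf.continuous.continuousOn
    refine ⟨max C 0, le_max_right _ _, fun p hp t ht => ?_⟩
    simpa using Or.inl (hC (t, p) ⟨ht, hp⟩)
  | succ m ih =>
    intro f hf S hS R h
    obtain ⟨C, hC0, hC⟩ := ih (TD_smooth hf) S hS R
      (fun p hp k hk => h p hp (k + 1) (by omega))
    refine ⟨C, hC0, fun p hp t ht => ?_⟩
    have key := norm_image_sub_le_of_norm_deriv_le_segment' (f := fun s => f (s, p))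
      (f' := fun s => TD f (s, p)) (a := 0) (b := t) (C := C * t ^ m)
      (fun x _ => (hasDerivAt_slice hf x p).hasDerivWithinAt)
      (fun x hx => (hC p hp x ⟨hx.1, hx.2.le.trans ht.2⟩).trans (by
        have := hx.1
        have := hx.2.le
        gcongr)) t ⟨ht.1, le_rfl⟩
    have h0 : f (0, p) = 0 := h p hp 0 (by omega)
    simp only [h0, sub_zero] at key
    rw [pow_succ, ← mul_assoc]
    exact key

lemma iteratedDeriv_zero_of_bound {h : ℝ → ℝ} (hh : ContDiff ℝ (⊤ : ℕ∞) h) (m : ℕ)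
    (hO : h =O[𝓝 0] fun t => t ^ m) (k : ℕ) : k < m → iteratedDeriv k h 0 = 0 := by
  induction k using Nat.strong_induction_on with
  | _ k ih =>
    intro hk
    have h1 := taylor_isLittleO_univ (x₀ := 0) (n := k) (hh.of_le (by exact_mod_cast le_top))
    have hT : ∀ x, taylorWithinEval h k univ 0 x
        = ((k.factorial : ℝ)⁻¹ * x ^ k) * iteratedDeriv k h 0 := by
      intro x
      rw [taylor_within_apply, Finset.sum_range_succ, Finset.sum_eq_zero]
      · simp [iteratedDerivWithin_univ]
      · intro j hj
        rw [Finset.mem_range] at hj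
        rw [iteratedDerivWithin_univ, ih j hj (hj.trans hk), smul_zero]
    simp only [hT, sub_zero] at h1
    have h2 : h =o[𝓝 0] fun t : ℝ => t ^ k :=
      hO.trans_isLittleO (Asymptotics.isLittleO_pow_pow hk)
    have h3 := h2.sub h1
    simp only [sub_sub_cancel] at h3
    by_contra hne
    have hc : ((k.factorial : ℝ)⁻¹ * iteratedDeriv k h 0) ≠ 0 :=
      mul_ne_zero (by positivity) hne
    have h4 : (fun t : ℝ => t ^ k) =o[𝓝 0] fun t : ℝ => t ^ k := by
      rw [← Asymptotics.isLittleO_const_mul_left_iff hc]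
      refine h3.congr_left fun x => by ring
    have h5 := h4.mono (nhdsWithin_le_nhds (s := {0}ᶜ))
    refine Asymptotics.isLittleO_irrefl ?_ h5
    refine Eventually.frequently ?_
    filter_upwards [self_mem_nhdsWithin] with x hx using pow_ne_zero k hx

lemma PD_vanish {f : ℝ × P → F} (hf : ContDiff ℝ (⊤ : ℕ∞) f) (O : Set P) (hO : IsOpen O)
    (m : ℕ) (h : ∀ p ∈ O, ∀ k < m, TD^[k] f (0, p) = 0) :
    ∀ p ∈ O, ∀ k < m, TD^[k] (PD f) (0, p) = 0 := by
  intro p hp k hk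
  rw [iter_PD k hf]
  have hs := iter_smooth k hf
  have h1 : HasFDerivAt (TD^[k] f) (fderiv ℝ (TD^[k] f) (0, p)) (0, p) :=
    (hs.differentiable (by simp) _).hasFDerivAt
  have h2 : HasFDerivAt (fun p' : P => TD^[k] f (0, p')) (PD (TD^[k] f) (0, p)) p :=
    h1.comp p (hasFDerivAt_prodMk_right (0 : ℝ) p)
  have h3 : (fun p' : P => TD^[k] f (0, p')) =ᶠ[𝓝 p] fun _ => 0 := by
    filter_upwards [hO.mem_nhds hp] with p' hp' using h p' hp' k hk
  exact h2.unique ((hasFDerivAt_const (0 : F) p).congr_of_eventuallyEq h3)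

theorem main_general {E : Type*} [NormedAddCommGroup E] [NormedSpace ℝ E] [ProperSpace E]
    (ν : ℕ) (hν : 2 ≤ ν)
    (U : Set (E × E))
    (hUopen : IsOpen U)
    (K : Set (E × E))
    (hK : IsCompact K) (hKU : K ⊆ U)
    (hKp : ∀ V ∈ K, ((0 : E), V.2) ∈ U)
    (Ψ : E × E → ℝ)
    (hΨ : ContDiff ℝ (⊤ : ℕ∞) Ψ)
    (c : ℝ) (hc : 1 ≤ c)
    (hlow : ∀ V ∈ U, (1 / c) * ‖V.1‖ ^ ν ≤ Ψ V)
    (hupp : ∀ V ∈ U, Ψ V ≤ c * ‖V.1‖ ^ ν) :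
    ∃ C : ℝ, 0 < C ∧ ∀ V ∈ K,
      ‖fderiv ℝ (fun x₁ => Ψ (x₁, V.2)) V.1‖ ≤ C * ‖V.1‖ ^ (ν - 1) ∧
      ‖fderiv ℝ (fun x₂ => Ψ (V.1, x₂)) V.2‖ ≤ C * ‖V.1‖ ^ ν := by
  have hnonneg : ∀ V ∈ U, 0 ≤ Ψ V := fun V hV => le_trans (by positivity) (hlow V hV)
  let g : ℝ × (E × E) → ℝ := fun q => Ψ (q.1 • q.2.1, q.2.2)
  have hg : ContDiff ℝ (⊤ : ℕ∞) g := by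
    have hin : ContDiff ℝ (⊤ : ℕ∞) (fun q : ℝ × (E × E) => (q.1 • q.2.1, q.2.2)) := by fun_prop
    exact hΨ.comp hin
  let O : Set (E × E) := {p | ((0 : E), p.2) ∈ U}
  have hO : IsOpen O := hUopen.preimage (continuous_const.prodMk continuous_snd)
  have hvan : ∀ p ∈ O, ∀ k < ν, TD^[k] g (0, p) = 0 := by
    intro p hp k hk
    rw [iter_eq_iteratedDeriv k hg]
    have hsl : ContDiff ℝ (⊤ : ℕ∞) (fun s : ℝ => g (s, p)) :=
      hg.comp (contDiff_id.prodMk contDiff_const)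
    refine iteratedDeriv_zero_of_bound hsl ν ?_ k hk
    refine Asymptotics.IsBigO.of_bound (c * ‖p.1‖ ^ ν) ?_
    have hcont : Continuous (fun s : ℝ => (s • p.1, p.2)) := by fun_prop
    have hev : ∀ᶠ s : ℝ in 𝓝 0, (s • p.1, p.2) ∈ U :=
      hcont.continuousAt.eventually_mem (hUopen.mem_nhds (by simpa [O] using hp))
    filter_upwards [hev] with s hs
    have h1 := hnonneg _ hs
    have h2 := hupp _ hs
    change ‖Ψ (s • p.1, p.2)‖ ≤ _
    rw [Real.norm_of_nonneg h1]
    refine h2.trans (le_of_eq ?_)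
    simp only [norm_smul, norm_pow, mul_pow]
    ring
  obtain ⟨R, hR⟩ := hK.isBounded.exists_norm_le
  have hS : IsCompact ((Metric.closedBall (0 : E) 1) ×ˢ (Prod.snd '' K)) :=
    (isCompact_closedBall (0 : E) 1).prod (hK.image continuous_snd)
  obtain ⟨C, hC0, hC⟩ := bound_of_vanish ν (PD_smooth hg) _ hS R (by
    rintro p ⟨_, V, hV, hVp⟩ k hk
    refine PD_vanish hg O hO ν hvan p ?_ k hk
    change ((0 : E), p.2) ∈ U
    rw [← hVp]
    exact hKp V hV)
  refine ⟨C + 1, by positivity, fun V hV => ?_⟩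
  have hd : HasFDerivAt Ψ (fderiv ℝ Ψ V) V := (hΨ.differentiable (by simp) _).hasFDerivAt
  have hd1 : HasFDerivAt (fun x₁ => Ψ (x₁, V.2))
      ((fderiv ℝ Ψ V).comp (ContinuousLinearMap.inl ℝ E E)) V.1 :=
    HasFDerivAt.comp V.1 (g := Ψ) (f := fun x₁ => (x₁, V.2)) hd (hasFDerivAt_prodMk_left V.1 V.2)
  have hd2 : HasFDerivAt (fun x₂ => Ψ (V.1, x₂))
      ((fderiv ℝ Ψ V).comp (ContinuousLinearMap.inr ℝ E E)) V.2 :=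
    HasFDerivAt.comp V.2 (g := Ψ) (f := fun x₂ => (V.1, x₂)) hd (hasFDerivAt_prodMk_right V.1 V.2)
  set t : ℝ := ‖V.1‖ with ht
  set u : E := t⁻¹ • V.1 with hu
  have ht0 : 0 ≤ t := norm_nonneg _
  have htu : t • u = V.1 := by
    by_cases h : t = 0
    · have : V.1 = 0 := norm_eq_zero.1 h
      simp [h, this]
    · rw [hu, smul_smul, mul_inv_cancel₀ h, one_smul]
  have hu1 : ‖u‖ ≤ 1 := by
    rw [hu, norm_smul, norm_inv, Real.norm_of_nonneg ht0, ← ht]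
    exact inv_mul_le_one
  have htR : t ≤ R := (norm_fst_le V).trans (hR V hV)
  have hb := hC (u, V.2) ⟨by simpa using hu1, V, hV, rfl⟩ t ⟨ht0, htR⟩
  -- formula for `PD g`
  have hform : ∀ v w : E, PD g (t, (u, V.2)) (v, w) = fderiv ℝ Ψ V (t • v, w) := by
    intro v w
    have e1 : HasFDerivAt (fun p : E × E => g (t, p)) (PD g (t, (u, V.2))) (u, V.2) :=
      ((hg.differentiable (by simp) _).hasFDerivAt).comp (u, V.2)
        (hasFDerivAt_prodMk_right t (u, V.2))
    let L : E × E →L[ℝ] E × E := (t • ContinuousLinearMap.fst ℝ E E).prod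
      (ContinuousLinearMap.snd ℝ E E)
    have hL : L (u, V.2) = V := by
      change (t • u, V.2) = V
      rw [htu]
    have e2 : HasFDerivAt (fun p : E × E => Ψ (L p)) ((fderiv ℝ Ψ V).comp L) (u, V.2) :=
      HasFDerivAt.comp (u, V.2) (by rw [hL]; exact hd) L.hasFDerivAt
    have e3 := e1.unique e2
    rw [e3]
    rfl
  have hbd : ∀ v w : E, |fderiv ℝ Ψ V (t • v, w)| ≤ C * t ^ ν * max ‖v‖ ‖w‖ := by
    intro v w
    rw [← hform, ← Real.norm_eq_abs]
    exact (ContinuousLinearMap.le_opNorm _ _).trans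
      (mul_le_mul_of_nonneg_right hb (norm_nonneg _))
  have htp : 0 ≤ t ^ (ν - 1) := pow_nonneg ht0 _
  have htp' : 0 ≤ t ^ ν := pow_nonneg ht0 _
  constructor
  · rcases ht0.eq_or_lt with h0 | hpos
    · have hV1 : V.1 = 0 := norm_eq_zero.1 h0.symm
      have hmin : IsLocalMin (fun x₁ => Ψ (x₁, V.2)) V.1 := by
        have hcont : Continuous (fun x : E => (x, V.2)) := by fun_prop
        have hev : ∀ᶠ x : E in 𝓝 V.1, (x, V.2) ∈ U :=
          hcont.continuousAt.eventually_mem (hUopen.mem_nhds (hKU hV))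
        filter_upwards [hev] with x hx
        have h1 := hupp V (hKU hV)
        rw [hV1, norm_zero, zero_pow (by omega), mul_zero] at h1
        exact h1.trans (hnonneg _ hx)
      rw [hmin.fderiv_eq_zero, norm_zero]
      positivity
    · rw [hd1.fderiv]
      refine ContinuousLinearMap.opNorm_le_bound _ (by positivity) fun v => ?_
      have h1 := hbd v 0
      have h2 : fderiv ℝ Ψ V (t • v, 0) = t * fderiv ℝ Ψ V (v, 0) := by
        rw [← smul_eq_mul, ← map_smul]
        simp
      rw [h2, abs_mul, abs_of_pos hpos, norm_zero, max_eq_left (norm_nonneg v)] at h1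
      have h3 : t ^ ν = t * t ^ (ν - 1) := by
        rw [← pow_succ']
        congr 1
        omega
      rw [h3] at h1
      have h4 : |fderiv ℝ Ψ V (v, 0)| ≤ C * t ^ (ν - 1) * ‖v‖ := by
        refine le_of_mul_le_mul_left (h1.trans (le_of_eq ?_)) hpos
        ring
      change |fderiv ℝ Ψ V (v, 0)| ≤ _
      refine h4.trans ?_
      gcongr
      linarith
  · rw [hd2.fderiv]
    refine ContinuousLinearMap.opNorm_le_bound _ (by positivity) fun w => ?_
    have h1 := hbd 0 w
    rw [smul_zero, norm_zero, max_eq_right (norm_nonneg w)] at h1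
    change |fderiv ℝ Ψ V (0, w)| ≤ _
    refine h1.trans ?_
    gcongr
    linarith

end Stmt2Aux

/-- Taylor-expansion estimates from the proof of Lemma 3.2: if `Ψ` is smooth and
comparable to `‖x₁‖^ν` near the subspace `Δ = {0} × ℝⁿ`, then its first partial
differential in the transverse variable is `O(‖x₁‖^(ν-1))` and in the diagonal
variable it is `O(‖x₁‖^ν)`, uniformly on a compact set `K`. -/
theorem stmt_2 (n ν : ℕ) (hn : 1 ≤ n) (hν : 2 ≤ ν)
    (U : Set (EuclideanSpace ℝ (Fin n) × EuclideanSpace ℝ (Fin n)))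
    (hUopen : IsOpen U) (hUconv : Convex ℝ U)
    (K : Set (EuclideanSpace ℝ (Fin n) × EuclideanSpace ℝ (Fin n)))
    (hK : IsCompact K) (hKU : K ⊆ U)
    (hKp : ∀ V ∈ K, ((0 : EuclideanSpace ℝ (Fin n)), V.2) ∈ U)
    (Ψ : EuclideanSpace ℝ (Fin n) × EuclideanSpace ℝ (Fin n) → ℝ)
    (hΨ : ContDiff ℝ (⊤ : ℕ∞) Ψ)
    (c : ℝ) (hc : 1 ≤ c)
    (hlow : ∀ V ∈ U, (1 / c) * ‖V.1‖ ^ ν ≤ Ψ V)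
    (hupp : ∀ V ∈ U, Ψ V ≤ c * ‖V.1‖ ^ ν) :
    ∃ C : ℝ, 0 < C ∧ ∀ V ∈ K,
      ‖fderiv ℝ (fun x₁ => Ψ (x₁, V.2)) V.1‖ ≤ C * ‖V.1‖ ^ (ν - 1) ∧
      ‖fderiv ℝ (fun x₂ => Ψ (V.1, x₂)) V.2‖ ≤ C * ‖V.1‖ ^ ν := by
  exact Stmt2Aux.main_general ν hν U hUopen K hK hKU hKp Ψ hΨ c hc hlow hupp
end

section
/- Let n ≥ 1 and ν ≥ 2 be integers, let Δ = {0} × ℝⁿ ⊂ ℝⁿ × ℝⁿ and p(x₁,x₂) = (0,x₂). Let U ⊆ ℝⁿ × ℝⁿ be open and convex, K ⊆ U compact with p(V) ∈ U for every V ∈ K, and let Ψ : ℝⁿ × ℝⁿ → ℝ be C^∞ with (1/c)‖x₁‖^ν ≤ Ψ(x₁,x₂) ≤ c‖x₁‖^ν on U for some c ≥ 1. Then there exists C > 0 such that for all V = (x₁,x₂) ∈ K and all vectors a, b ∈ ℝⁿ, |DΨ(V)(a,b)| ≤ C‖x₁‖^{ν−1}(‖a‖ + ‖x₁‖·‖b‖),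 where DΨ(V)(a,b) denotes the differential of Ψ at V applied to the direction (a,b) ∈ ℝⁿ × ℝⁿ. -/
open Asymptotics Filter Topology in
lemma aux_zero (f : ℝ → ℝ) (hf : ContDiff ℝ (⊤ : ℕ∞) f) (ν : ℕ)
    (hO : f =O[𝓝 0] fun s => s ^ ν) (j : ℕ) (hj : j < ν) : iteratedDeriv j f 0 = 0 := by
  induction j using Nat.strong_induction_on with
  | _ j ih =>
    have h1 := taylor_isLittleO_univ (f := f) (x₀ := 0) (n := j)
      (hf.of_le (by exact_mod_cast le_top))
    have h2 : f =o[𝓝 0] fun s : ℝ => s ^ j :=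
      hO.trans_isLittleO (isLittleO_pow_pow hj)
    simp only [sub_zero] at h1
    have h3 := h2.sub h1
    simp only [sub_sub_cancel] at h3
    have h4 : ∀ x, taylorWithinEval f j Set.univ 0 x
        = ((j.factorial : ℝ)⁻¹ * iteratedDeriv j f 0) * x ^ j := by
      intro x
      rw [taylor_within_apply, Finset.sum_range_succ, Finset.sum_eq_zero]
      · simp [iteratedDerivWithin_univ]; ring
      · intro k hk
        have hk' := Finset.mem_range.1 hk
        simp [iteratedDerivWithin_univ, ih k hk' (hk'.trans hj)]
    simp only [h4] at h3
    by_contra hne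
    have hne' : (j.factorial : ℝ)⁻¹ * iteratedDeriv j f 0 ≠ 0 :=
      mul_ne_zero (by positivity) hne
    rw [isLittleO_const_mul_left_iff hne'] at h3
    have h5 := h3.mono (nhdsWithin_le_nhds (s := {0}ᶜ))
    refine isLittleO_irrefl ?_ h5
    apply Eventually.frequently
    filter_upwards [self_mem_nhdsWithin] with x hx
    exact pow_ne_zero _ hx

open Asymptotics Filter Topology in
lemma aux_taylor (f : ℝ → ℝ) (hf : ContDiff ℝ (⊤ : ℕ∞) f) (ν : ℕ) (hν : 1 ≤ ν)
    (hO : f =O[𝓝 0] fun s => s ^ ν) (B : ℝ)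
    (hB : ∀ s ∈ Set.Icc (0:ℝ) 1, |iteratedDeriv ν f s| ≤ B) : |f 1| ≤ B := by
  obtain ⟨m, rfl⟩ : ∃ m, ν = m + 1 := ⟨ν - 1, by omega⟩
  have hw : ∀ (k : ℕ), ∀ s ∈ Set.Icc (0:ℝ) 1,
      iteratedDerivWithin k f (Set.Icc 0 1) s = iteratedDeriv k f s := fun k s hs =>
    iteratedDerivWithin_eq_iteratedDeriv (uniqueDiffOn_Icc one_pos)
      (hf.of_le (by exact_mod_cast le_top)).contDiffAt hs
  have h := taylor_mean_remainder_bound (f := f) (a := 0) (b := 1) (C := B) (x := 1) (n := m)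
    zero_le_one (hf.of_le (by exact_mod_cast le_top)).contDiffOn (by simp)
    (fun y hy => by rw [hw _ y hy]; exact hB y hy)
  have hT : taylorWithinEval f m (Set.Icc 0 1) 0 1 = 0 := by
    rw [taylor_within_apply]
    apply Finset.sum_eq_zero
    intro k hk
    rw [hw k 0 (by simp), aux_zero f hf _ hO k (Finset.mem_range.1 hk), smul_zero]
  rw [hT] at h
  simp only [sub_zero, one_pow, mul_one, Real.norm_eq_abs] at h
  have hB0 : 0 ≤ B := (abs_nonneg _).trans (hB 0 (by simp))
  refine h.trans (div_le_self hB0 ?_)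
  exact_mod_cast Nat.factorial_pos m

lemma aux_line {E : Type*} [NormedAddCommGroup E] [NormedSpace ℝ E] (Ψ : E → ℝ)
    (hΨ : ContDiff ℝ (⊤ : ℕ∞) Ψ) (q w : E) (k : ℕ) (s : ℝ) :
    iteratedDeriv k (fun s : ℝ => Ψ (q + s • w)) s
      = iteratedFDeriv ℝ k Ψ (q + s • w) (fun _ => w) := by
  have hc : ContDiff ℝ (⊤ : ℕ∞) (fun v => Ψ (q + v)) := hΨ.comp (contDiff_const.add contDiff_id)
  have := (ContinuousLinearMap.toSpanSingleton ℝ w).iteratedFDeriv_comp_right hc s (i := k)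
    (by exact_mod_cast le_top)
  rw [iteratedDeriv_eq_iteratedFDeriv]
  change iteratedFDeriv ℝ k ((fun v => Ψ (q + v)) ∘ (ContinuousLinearMap.toSpanSingleton ℝ w)) s _ = _
  rw [this, iteratedFDeriv_comp_add_left]
  simp

lemma aux_mult {E : Type*} [NormedAddCommGroup E] [NormedSpace ℝ E] (k : ℕ)
    (A A' : ContinuousMultilinearMap ℝ (fun _ : Fin k => E) ℝ) (u w : E) :
    |A (fun _ => u) - A' (fun _ => w)| ≤ ‖A - A'‖ * ‖u‖ ^ k
      + ‖A'‖ * k * max ‖u‖ ‖w‖ ^ (k - 1) * ‖u - w‖ := by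
  have h1 : |(A - A') (fun _ => u)| ≤ ‖A - A'‖ * ‖u‖ ^ k := by
    simpa using (A - A').le_opNorm (fun _ => u)
  have h2 := A'.norm_image_sub_le (fun _ => u) (fun _ => w)
  rw [Real.norm_eq_abs] at h2
  have e1 : ‖(fun _ : Fin k => u)‖ ≤ ‖u‖ := pi_norm_const_le u
  have e2 : ‖(fun _ : Fin k => w)‖ ≤ ‖w‖ := pi_norm_const_le w
  have e3 : ‖(fun _ : Fin k => u) - (fun _ : Fin k => w)‖ ≤ ‖u - w‖ := pi_norm_const_le (u - w)
  have h3 : |A' (fun _ => u) - A' (fun _ => w)| ≤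
      ‖A'‖ * k * max ‖u‖ ‖w‖ ^ (k - 1) * ‖u - w‖ := by
    refine h2.trans ?_
    rw [Fintype.card_fin]
    gcongr
  have : A (fun _ => u) - A' (fun _ => w)
      = (A - A') (fun _ => u) + (A' (fun _ => u) - A' (fun _ => w)) := by
    simp
  rw [this]
  exact (abs_add_le _ _).trans (add_le_add h1 h3)

open Asymptotics Filter Topology in
lemma aux_O {E : Type*} [NormedAddCommGroup E] [NormedSpace ℝ E] (U : Set (E × E))
    (hU : IsOpen U) (Ψ : E × E → ℝ) (c : ℝ) (hc : 1 ≤ c) (ν : ℕ)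
    (hlow : ∀ V ∈ U, (1 / c) * ‖V.1‖ ^ ν ≤ Ψ V)
    (hupp : ∀ V ∈ U, Ψ V ≤ c * ‖V.1‖ ^ ν) (y u : E) (hy : ((0 : E), y) ∈ U) :
    (fun s : ℝ => Ψ (((0 : E), y) + s • (u, (0 : E)))) =O[𝓝 0] fun s => s ^ ν := by
  refine IsBigO.of_bound (c * ‖u‖ ^ ν) ?_
  have hcont : Continuous (fun s : ℝ => ((0 : E), y) + s • (u, (0 : E))) := by fun_prop
  have hmem : ∀ᶠ s in 𝓝 (0:ℝ), ((0 : E), y) + s • (u, (0 : E)) ∈ U :=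
    hcont.continuousAt.eventually_mem (hU.mem_nhds (by simpa using hy))
  filter_upwards [hmem] with s hs
  have h1 := hlow _ hs
  have h2 := hupp _ hs
  have h0 : 0 ≤ Ψ (((0 : E), y) + s • (u, (0 : E))) := le_trans (by positivity) h1
  rw [Real.norm_eq_abs, abs_of_nonneg h0]
  refine h2.trans (le_of_eq ?_)
  simp [norm_smul, mul_pow]
  ring

open Filter Topology in
/-- Coordinate form of Lemma 3.2: if `Ψ` is smooth and comparable to `‖x₁‖^ν`
near the subspace `Δ = {0} × ℝⁿ`, then its differential at `V = (x₁, x₂) ∈ K`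
in a direction `(a, b)` is bounded by `C ‖x₁‖^(ν-1) (‖a‖ + ‖x₁‖ ‖b‖)`. -/
theorem stmt_3 (n ν : ℕ) (hn : 1 ≤ n) (hν : 2 ≤ ν)
    (U : Set (EuclideanSpace ℝ (Fin n) × EuclideanSpace ℝ (Fin n)))
    (hUopen : IsOpen U) (hUconv : Convex ℝ U)
    (K : Set (EuclideanSpace ℝ (Fin n) × EuclideanSpace ℝ (Fin n)))
    (hK : IsCompact K) (hKU : K ⊆ U)
    (hKp : ∀ V ∈ K, ((0 : EuclideanSpace ℝ (Fin n)), V.2) ∈ U)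
    (Ψ : EuclideanSpace ℝ (Fin n) × EuclideanSpace ℝ (Fin n) → ℝ)
    (hΨ : ContDiff ℝ (⊤ : ℕ∞) Ψ)
    (c : ℝ) (hc : 1 ≤ c)
    (hlow : ∀ V ∈ U, (1 / c) * ‖V.1‖ ^ ν ≤ Ψ V)
    (hupp : ∀ V ∈ U, Ψ V ≤ c * ‖V.1‖ ^ ν) :
    ∃ C : ℝ, 0 < C ∧ ∀ V ∈ K, ∀ a b : EuclideanSpace ℝ (Fin n),
      |fderiv ℝ Ψ V (a, b)| ≤ C * ‖V.1‖ ^ (ν - 1) * (‖a‖ + ‖V.1‖ * ‖b‖) := by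
  classical
  obtain ⟨R, hR0, hR⟩ : ∃ R : ℝ, 0 < R ∧ ∀ V ∈ K, ‖V‖ ≤ R := by
    obtain ⟨R, hR0, hR⟩ := hK.isBounded.exists_pos_norm_le
    exact ⟨R, hR0, hR⟩
  let E := EuclideanSpace ℝ (Fin n)
  let S : Set (E × E) := Metric.closedBall 0 (R + 1)
  have hS : IsCompact S := isCompact_closedBall _ _
  have hD : ContDiff ℝ 1 (iteratedFDeriv ℝ ν Ψ) :=
    hΨ.iteratedFDeriv_right (by exact_mod_cast le_top)
  obtain ⟨B, hB⟩ := hS.exists_bound_of_continuousOn hD.continuous.continuousOn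
  obtain ⟨L, hL⟩ := hS.exists_bound_of_continuousOn (hD.continuous_fderiv one_ne_zero).continuousOn
  have h0S : (0 : E × E) ∈ S := by simp [S]; linarith
  have hB0 : 0 ≤ B := (norm_nonneg _).trans (hB 0 h0S)
  have hL0 : 0 ≤ L := (norm_nonneg _).trans (hL 0 h0S)
  have hLip : ∀ p ∈ S, ∀ q ∈ S, ‖iteratedFDeriv ℝ ν Ψ p - iteratedFDeriv ℝ ν Ψ q‖ ≤ L * ‖p - q‖ :=
    fun p hp q hq => Convex.norm_image_sub_le_of_norm_fderiv_le
      (fun x _ => (hD.differentiable one_ne_zero) x) hL (convex_closedBall _ _) hq hp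
  refine ⟨L * R + B * ν + L + 1, by positivity, ?_⟩
  rintro ⟨x, y⟩ hV a b
  have hVR := hR _ hV
  have hyU := hKp _ hV
  simp only at hyU ⊢
  have hxR : ‖x‖ ≤ R := (norm_fst_le (x, y)).trans hVR
  -- the estimate at step t
  have key : ∀ᶠ t in 𝓝[>] (0:ℝ), |t⁻¹ • (Ψ ((x, y) + t • (a, b)) - Ψ (x, y))| ≤
      L * (‖a‖ + ‖b‖) * ‖x + t • a‖ ^ ν
        + B * ν * max ‖x + t • a‖ ‖x‖ ^ (ν - 1) * ‖a‖ := by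
    have e1 : ∀ᶠ t in 𝓝 (0:ℝ), ((0 : E), y + t • b) ∈ U := by
      have hcont : Continuous (fun t : ℝ => ((0 : E), y + t • b)) := by fun_prop
      exact hcont.continuousAt.eventually_mem (hUopen.mem_nhds (by simpa using hyU))
    have e2 : ∀ᶠ t in 𝓝 (0:ℝ), ‖(x, y) + t • (a, b)‖ < R + 1 := by
      have hcont : Continuous (fun t : ℝ => ‖(x, y) + t • (a, b)‖) := by fun_prop
      refine hcont.continuousAt.eventually_lt continuousAt_const ?_
      simpa using lt_of_le_of_lt hVR (lt_add_one R)
    filter_upwards [self_mem_nhdsWithin, nhdsWithin_le_nhds e1, nhdsWithin_le_nhds e2]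
      with t ht h1 h2
    have ht : 0 < t := ht
    let q₁ : E × E := (0, y + t • b)
    let q₂ : E × E := (0, y)
    let w₁ : E × E := (x + t • a, 0)
    let w₂ : E × E := (x, 0)
    have hf₁ : ContDiff ℝ (⊤ : ℕ∞) (fun s : ℝ => Ψ (q₁ + s • w₁)) := hΨ.comp (by fun_prop)
    have hf₂ : ContDiff ℝ (⊤ : ℕ∞) (fun s : ℝ => Ψ (q₂ + s • w₂)) := hΨ.comp (by fun_prop)
    have hO := (aux_O U hUopen Ψ c hc ν hlow hupp (y + t • b) (x + t • a) h1).sub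
      (aux_O U hUopen Ψ c hc ν hlow hupp y x hyU)
    have hfin := aux_taylor ((fun s : ℝ => Ψ (q₁ + s • w₁)) - (fun s : ℝ => Ψ (q₂ + s • w₂)))
      (hf₁.sub hf₂) ν (by omega) hO
      (t * (L * (‖a‖ + ‖b‖) * ‖x + t • a‖ ^ ν
        + B * ν * max ‖x + t • a‖ ‖x‖ ^ (ν - 1) * ‖a‖)) ?_
    · have g1 : q₁ + (1:ℝ) • w₁ = (x, y) + t • (a, b) := by
        simp [q₁, w₁]
      have g2 : q₂ + (1:ℝ) • w₂ = (x, y) := by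
        simp [q₂, w₂]
      rw [Pi.sub_apply] at hfin
      simp only [g1, g2] at hfin
      rw [smul_eq_mul, abs_mul, abs_of_pos (inv_pos.2 ht), inv_mul_le_iff₀ ht]
      exact hfin
    · rintro s ⟨hs0, hs1⟩
      rw [iteratedDeriv_sub (hf₁.of_le (by exact_mod_cast le_top)).contDiffAt
        (hf₂.of_le (by exact_mod_cast le_top)).contDiffAt, aux_line Ψ hΨ, aux_line Ψ hΨ]
      have hsc : ∀ z : E, ‖s • z‖ ≤ ‖z‖ := fun z => by
        rw [norm_smul, Real.norm_of_nonneg hs0]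
        exact mul_le_of_le_one_left (norm_nonneg _) hs1
      have hp₁ : q₁ + s • w₁ ∈ S := by
        simp only [S, mem_closedBall_zero_iff]
        refine le_trans ?_ h2.le
        simp only [q₁, w₁, Prod.smul_mk, Prod.mk_add_mk, Prod.norm_mk, zero_add, smul_zero,
          add_zero]
        exact max_le_max (hsc _) le_rfl
      have hp₂ : q₂ + s • w₂ ∈ S := by
        simp only [S, mem_closedBall_zero_iff]
        refine le_trans ?_ (hVR.trans (by linarith))
        simp only [q₂, w₂, Prod.smul_mk, Prod.mk_add_mk, Prod.norm_mk, zero_add, smul_zero,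
          add_zero]
        exact max_le_max (hsc _) le_rfl
      have hpq : ‖(q₁ + s • w₁) - (q₂ + s • w₂)‖ ≤ t * (‖a‖ + ‖b‖) := by
        have : (q₁ + s • w₁) - (q₂ + s • w₂) = t • (s • a, b) := by
          simp only [q₁, q₂, w₁, w₂, Prod.smul_mk, Prod.mk_add_mk, Prod.mk_sub_mk]
          ext1
          · simp only; module
          · simp only; module
        rw [this, norm_smul, Real.norm_of_nonneg ht.le, Prod.norm_mk]
        gcongr
        exact max_le ((hsc a).trans (by linarith [norm_nonneg b])) (by linarith [norm_nonneg a])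
      have hw : ‖w₁ - w₂‖ = t * ‖a‖ := by
        simp [w₁, w₂, Prod.norm_mk, norm_smul, abs_of_pos ht]
        positivity
      have n₁ : ‖w₁‖ = ‖x + t • a‖ := by simp [w₁, Prod.norm_mk]
      have n₂ : ‖w₂‖ = ‖x‖ := by simp [w₂, Prod.norm_mk]
      refine (aux_mult ν _ _ w₁ w₂).trans ?_
      rw [hw, n₁, n₂]
      have i1 := (hLip _ hp₁ _ hp₂).trans (mul_le_mul_of_nonneg_left hpq hL0)
      have i2 := hB _ hp₂
      calc _ ≤ (L * (t * (‖a‖ + ‖b‖))) * ‖x + t • a‖ ^ ν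
            + B * ν * max ‖x + t • a‖ ‖x‖ ^ (ν - 1) * (t * ‖a‖) := by gcongr
        _ = _ := by ring
  have lim1 : Tendsto (fun t : ℝ => |t⁻¹ • (Ψ ((x, y) + t • (a, b)) - Ψ (x, y))|) (𝓝[>] 0)
      (𝓝 |fderiv ℝ Ψ (x, y) (a, b)|) := by
    have hd : HasFDerivAt Ψ (fderiv ℝ Ψ (x, y)) (x, y) :=
      ((hΨ.differentiable (by simp)) (x, y)).hasFDerivAt
    have := (hd.hasLineDerivAt (a, b)).tendsto_slope_zero_right
    exact this.abs
  have lim2 : Tendsto (fun t : ℝ => L * (‖a‖ + ‖b‖) * ‖x + t • a‖ ^ ν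
        + B * ν * max ‖x + t • a‖ ‖x‖ ^ (ν - 1) * ‖a‖) (𝓝[>] 0)
      (𝓝 (L * (‖a‖ + ‖b‖) * ‖x‖ ^ ν + B * ν * ‖x‖ ^ (ν - 1) * ‖a‖)) := by
    have hcont : Continuous (fun t : ℝ => L * (‖a‖ + ‖b‖) * ‖x + t • a‖ ^ ν
        + B * ν * max ‖x + t • a‖ ‖x‖ ^ (ν - 1) * ‖a‖) := by fun_prop
    have := (hcont.tendsto 0).mono_left (nhdsWithin_le_nhds (s := Set.Ioi 0))
    simpa using this
  refine (le_of_tendsto_of_tendsto lim1 lim2 key).trans ?_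
  have hpow : ‖x‖ ^ ν = ‖x‖ ^ (ν - 1) * ‖x‖ := by
    rw [← pow_succ]; congr 1; omega
  rw [hpow]
  set P := ‖x‖ ^ (ν - 1)
  have hP : 0 ≤ P := by positivity
  have j1 : L * P * ‖a‖ * ‖x‖ ≤ L * P * ‖a‖ * R := by gcongr
  have j2 : 0 ≤ (L + 1) * P * ‖a‖ := by positivity
  have j3 : 0 ≤ (L * R + B * ν + 1) * P * (‖x‖ * ‖b‖) := by positivity
  nlinarith [j1, j2, j3]
end
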